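/- For every q ∈ ℳ and every real γ > 0 there exists N such that for all n ≥ N, the polynomial q(x)·(x+γ)^n has nonnegative coefficients; equivalently, q·((X+γ)/(1+γ))^n ∈ 𝒫 for all n large enough. -/

import Mathlib

open Polynomial

/-- `Mset` is the set of real polynomials `p` with `p(1) = 1` that are positive on the
positive reals. -/
def Mset : Set (Polynomial ℝ) := {p | p.eval 1 = 1 ∧ ∀ x : ℝ, 0 < x → 0 < p.eval x}

/-- The coefficients of `p * (X + γ) ^ n` are nonnegative for all large `n`. -/
def EventuallyNonnegCoeff (γ : ℝ) (p : ℝ[X]) : Prop :=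
  ∃ N : ℕ, ∀ n ≥ N, ∀ k : ℕ, 0 ≤ (p * (X + C γ) ^ n).coeff k

theorem coeff_mul_nonneg {p q : ℝ[X]} (hp : ∀ k, 0 ≤ p.coeff k) (hq : ∀ k, 0 ≤ q.coeff k)
    (k : ℕ) : 0 ≤ (p * q).coeff k := by
  rw [coeff_mul]
  exact Finset.sum_nonneg fun _ _ => mul_nonneg (hp _) (hq _)

theorem coeff_X_add_C_pow_nonneg {γ : ℝ} (hγ : 0 ≤ γ) (n k : ℕ) :
    0 ≤ ((X + C γ) ^ n).coeff k := by
  rw [coeff_X_add_C_pow]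
  positivity

theorem EventuallyNonnegCoeff.mul {γ : ℝ} {p q : ℝ[X]} (hp : EventuallyNonnegCoeff γ p)
    (hq : EventuallyNonnegCoeff γ q) : EventuallyNonnegCoeff γ (p * q) := by
  obtain ⟨N, hN⟩ := hp
  obtain ⟨M, hM⟩ := hq
  refine ⟨N + M, fun n hn k => ?_⟩
  have h : p * q * (X + C γ) ^ n = p * (X + C γ) ^ N * (q * (X + C γ) ^ (n - N)) := by
    rw [mul_mul_mul_comm, ← pow_add, Nat.add_sub_cancel' (by omega)]
  rw [h]
  exact coeff_mul_nonneg (hN N le_rfl) (hM (n - N) (by omega)) k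

theorem eventuallyNonnegCoeff_of_coeff_nonneg {γ : ℝ} (hγ : 0 ≤ γ) {p : ℝ[X]}
    (hp : ∀ k, 0 ≤ p.coeff k) : EventuallyNonnegCoeff γ p :=
  ⟨0, fun n _ => coeff_mul_nonneg hp (coeff_X_add_C_pow_nonneg hγ n)⟩

/-- The coefficients of a quadratic multiple of `(X + γ) ^ n` in terms of those of
`(X + γ) ^ (n + 2)`. -/
theorem coeff_quadratic_mul_X_add_C_pow (γ a c : ℝ) (n k : ℕ) :
    γ ^ 2 * ((n + 2) * (n + 1)) * ((X ^ 2 - C (2 * a) * X + C c) * (X + C γ) ^ n).coeff k =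
      (γ ^ 2 * (k * (k - 1)) - 2 * a * γ * (k * (n + 2 - k))
        + c * ((n + 2 - k) * (n + 2 - k - 1))) * ((X + C γ) ^ (n + 2)).coeff k := by
  have coeff_X_mul_derivative (p : ℝ[X]) : (X * derivative p).coeff k = k * p.coeff k := by
    cases k with
    | zero => simp
    | succ k => rw [coeff_X_mul, coeff_derivative]; push_cast; ring
  set f : ℝ[X] := (X + C γ) ^ n with hf
  have h₁ : X * derivative ((X + C γ) ^ (n + 2)) =
      C ((n : ℝ) + 2) * (X ^ 2 * f + C γ * (X * f)) := by
    rw [derivative_X_add_C_pow]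
    simp only [hf, show n + 2 - 1 = n + 1 by omega]
    simp only [map_add, map_natCast, map_ofNat]
    push_cast
    ring
  have h₂ : X * derivative (X * derivative ((X + C γ) ^ (n + 2))) =
      X * derivative ((X + C γ) ^ (n + 2)) + C (((n : ℝ) + 2) * (n + 1)) * (X ^ 2 * f) := by
    simp only [derivative_mul, derivative_X_add_C_pow, derivative_X, derivative_natCast, hf,
      show n + 2 - 1 = n + 1 by omega, Nat.add_sub_cancel, map_mul, map_add, map_natCast,
      map_ofNat, map_one]
    push_cast
    ring
  have h₃ : (X + C γ) ^ (n + 2) = X ^ 2 * f + C (2 * γ) * (X * f) + C (γ ^ 2) * f := by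
    simp only [hf, map_mul, map_pow, map_ofNat]
    ring
  have h₄ : (X ^ 2 - C (2 * a) * X + C c) * f = X ^ 2 * f - C (2 * a) * (X * f) + C c * f := by
    ring
  have e₁ := congrArg (coeff · k) h₁
  have e₂ := congrArg (coeff · k) h₂
  have e₃ := congrArg (coeff · k) h₃
  simp only [coeff_X_mul_derivative, coeff_add, coeff_C_mul] at e₁ e₂ e₃
  rw [h₄]
  simp only [coeff_add, coeff_sub, coeff_C_mul]
  generalize (X ^ 2 * f).coeff k = A at *
  generalize (X * f).coeff k = B at *
  generalize f.coeff k = D at *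
  generalize ((X + C γ) ^ (n + 2)).coeff k = G at *
  have hA : ((n : ℝ) + 2) * (n + 1) * A = k * (k - 1) * G := by linear_combination -e₂
  have hB : ((n : ℝ) + 2) * (n + 1) * (γ * B) = k * (n + 2 - k) * G := by
    linear_combination -(n + 1 : ℝ) * e₁ - hA
  have hD : ((n : ℝ) + 2) * (n + 1) * (γ ^ 2 * D) = (n + 2 - k) * (n + 2 - k - 1) * G := by
    linear_combination -((n : ℝ) + 2) * (n + 1) * e₃ - hA - 2 * hB
  linear_combination γ ^ 2 * hA - 2 * a * γ * hB + c * hD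

/-- A positive definite quadratic form dominates a linear form far from the origin. -/
theorem exists_linear_le_quadratic {γ a c : ℝ} (hγ : 0 < γ) (hc : a ^ 2 < c) :
    ∃ N : ℕ, ∀ x y : ℝ, (N : ℝ) ≤ x + y →
      γ ^ 2 * x + c * y ≤ γ ^ 2 * x ^ 2 - 2 * a * γ * (x * y) + c * y ^ 2 := by
  have hd : 0 < c - a ^ 2 := sub_pos.2 hc
  set d := c - a ^ 2 with hd_def
  set K := 2 + (2 * a ^ 2 + 1) / d with hK
  have hKpos : 0 < K := by positivity
  obtain ⟨N, hN⟩ := exists_nat_ge (1 + (1 + γ ^ 2) * (K ^ 2 * (γ ^ 2 + c ^ 2)) / γ ^ 2)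
  refine ⟨N, fun x y hxy => ?_⟩
  set Q := γ ^ 2 * x ^ 2 - 2 * a * γ * (x * y) + c * y ^ 2 with hQ
  have hQeq : Q = (γ * x - a * y) ^ 2 + d * y ^ 2 := by rw [hQ, hd_def]; ring
  have hKQ : γ ^ 2 * x ^ 2 + y ^ 2 ≤ K * Q := by
    have h : K * Q = 2 * (γ * x - a * y) ^ 2 + 2 * d * y ^ 2
        + (2 * a ^ 2 + 1) / d * (γ * x - a * y) ^ 2 + (2 * a ^ 2 + 1) * y ^ 2 := by
      rw [hQeq, hK]; field_simp; ring
    have h' : 0 ≤ (2 * a ^ 2 + 1) / d * (γ * x - a * y) ^ 2 := by positivity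
    have h'' : 0 ≤ 2 * d * y ^ 2 := by positivity
    nlinarith [sq_nonneg (γ * x - 2 * a * y)]
  have hlarge : K ^ 2 * (γ ^ 2 + c ^ 2) ≤ γ ^ 2 * x ^ 2 + y ^ 2 := by
    have hγ2 : 0 < γ ^ 2 := by positivity
    have h₀ : 0 ≤ (1 + γ ^ 2) * (K ^ 2 * (γ ^ 2 + c ^ 2)) / γ ^ 2 := by positivity
    have h₁ : (1 + γ ^ 2) * (K ^ 2 * (γ ^ 2 + c ^ 2)) ≤ (x + y) * γ ^ 2 := by
      rw [← div_le_iff₀ hγ2]; linarith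
    have h₂ : x + y ≤ (x + y) ^ 2 := by nlinarith
    have h₃ : (x + y) * γ ^ 2 ≤ (x + y) ^ 2 * γ ^ 2 := by gcongr
    have h₄ : (x + y) ^ 2 * γ ^ 2 ≤ (1 + γ ^ 2) * (γ ^ 2 * x ^ 2 + y ^ 2) := by
      nlinarith [sq_nonneg (γ ^ 2 * x - y)]
    exact le_of_mul_le_mul_left (h₁.trans (h₃.trans h₄)) (by positivity)
  refine le_of_mul_le_mul_left ?_ hKpos
  nlinarith [sq_nonneg (γ * x - K * γ), sq_nonneg (y - K * c)]

theorem eventuallyNonnegCoeff_quadratic {γ a c : ℝ} (hγ : 0 < γ) (hc : a ^ 2 < c) :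
    EventuallyNonnegCoeff γ (X ^ 2 - C (2 * a) * X + C c) := by
  obtain ⟨N, hN⟩ := exists_linear_le_quadratic hγ hc
  refine ⟨N, fun n hn k => ?_⟩
  have hpos : 0 < γ ^ 2 * (((n : ℝ) + 2) * (n + 1)) := by positivity
  refine nonneg_of_mul_nonneg_right ?_ hpos
  rw [coeff_quadratic_mul_X_add_C_pow]
  refine mul_nonneg ?_ (coeff_X_add_C_pow_nonneg hγ.le _ _)
  have hn' : (N : ℝ) ≤ n := by exact_mod_cast hn
  have := hN k (n + 2 - k) (by linarith)
  linarith

theorem eventuallyNonnegCoeff_of_pos {γ : ℝ} (hγ : 0 < γ) (q : ℝ[X])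
    (hq : ∀ x : ℝ, 0 < x → 0 < q.eval x) : EventuallyNonnegCoeff γ q := by
  induction hd : q.natDegree using Nat.strong_induction_on generalizing q with
  | _ d ih =>
  have hq0 : q ≠ 0 := by
    rintro rfl
    simpa using hq 1 one_pos
  have of_dvd {p : ℝ[X]} (hpq : p ∣ q) (hdeg : 0 < p.natDegree)
      (hpos : ∀ x : ℝ, 0 < x → 0 ≤ p.eval x) (hp : EventuallyNonnegCoeff γ p) :
      EventuallyNonnegCoeff γ q := by
    obtain ⟨r, rfl⟩ := hpq
    have hp0 := left_ne_zero_of_mul hq0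
    have hr0 := right_ne_zero_of_mul hq0
    rw [natDegree_mul hp0 hr0] at hd
    refine hp.mul (ih r.natDegree (by omega) r (fun x hx => ?_) rfl)
    have h := hq x hx
    rw [eval_mul] at h
    exact pos_of_mul_pos_right h (hpos x hx)
  rcases Nat.eq_zero_or_pos q.natDegree with h0 | h0
  · rw [eq_C_of_natDegree_eq_zero h0] at hq ⊢
    have hc : 0 < q.coeff 0 := by simpa using hq 1 one_pos
    refine eventuallyNonnegCoeff_of_coeff_nonneg hγ.le fun k => ?_
    rw [coeff_C]
    split_ifs <;> simp [hc.le]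
  · obtain ⟨z, hz⟩ := IsAlgClosed.exists_aeval_eq_zero ℂ q
      (natDegree_pos_iff_degree_pos.1 h0).ne'
    by_cases him : z.im = 0
    · have hzr : z = algebraMap ℝ ℂ z.re := Complex.ext (by simp) (by simp [him])
      have hroot : q.IsRoot z.re := by
        rw [hzr, aeval_algebraMap_apply_eq_algebraMap_eval] at hz
        simpa using hz
      have hre : z.re ≤ 0 := by
        by_contra! h
        exact (hq _ h).ne' hroot
      refine of_dvd (dvd_iff_isRoot.2 hroot) (by simp)
        (fun x hx => by simp only [eval_sub, eval_X, eval_C]; linarith)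
        (eventuallyNonnegCoeff_of_coeff_nonneg hγ.le fun k => ?_)
      rw [coeff_sub, coeff_X, coeff_C]
      split_ifs <;> linarith
    · have hsq : ‖z‖ ^ 2 = z.re ^ 2 + z.im ^ 2 := by
        rw [Complex.sq_norm, Complex.normSq_apply]; ring
      have him2 : 0 < z.im ^ 2 := by positivity
      refine of_dvd (quadratic_dvd_of_aeval_eq_zero_im_ne_zero q hz him) ?_ (fun x _ => ?_)
        (eventuallyNonnegCoeff_quadratic hγ (by linarith))
      · have : (X ^ 2 - C (2 * z.re) * X + C (‖z‖ ^ 2) : ℝ[X]).natDegree = 2 := by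
          compute_degree!
        omega
      · simp only [eval_add, eval_sub, eval_mul, eval_pow, eval_X, eval_C]
        nlinarith [sq_nonneg (x - z.re)]

theorem stmt_6 (q : Polynomial ℝ) (hq : q ∈ Mset) (γ : ℝ) (hγ : 0 < γ) :
    ∃ N : ℕ, ∀ n ≥ N, ∀ k : ℕ, 0 ≤ (q * (X + C γ) ^ n).coeff k :=
  eventuallyNonnegCoeff_of_pos hγ q hq.2
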